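/- Let n5 be the 7-dimensional nilpotent real Lie algebra with basis e1,…,e7 and only nonzero brackets [e1,e2] = −e5, [e3,e4] = −e6 (up to antisymmetry). Then: (i) the space of closed alternating 4-forms on n5 has dimension 28; (ii) the space of derivations of n5 has dimension 23; (iii) the 4-form ψ = −e^{1234}+e^{1257}+e^{1267}−e^{1356}+e^{1467}−e^{2367}−e^{2456}−e^{3457} is closed and the space of derivations stabilizing ψ has dimension 1; (iv) there exists δ > 0 such that for every real ε with 0 < |ε| < δ, the only derivation of n5 stabilizing ψ_ε := ψ + ε(e^{2356}+e^{2457}) is 0. -/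

import Mathlib

noncomputable section

/-- The underlying 7-dimensional real vector space. -/
abbrev V : Type := Fin 7 → ℝ

/-- The Lie bracket of the nilpotent Lie algebra `n₅` ([e1,e2] = -e5, [e3,e4] = -e6), extended bilinearly from the structure constants. -/
def bk (x y : V) : V :=
  ![0, 0, 0, 0, -(x 0 * y 1 - x 1 * y 0), -(x 2 * y 3 - x 3 * y 2), 0]

/-- The alternating 4-form `e^i ∧ e^j ∧ e^k ∧ e^l` on `V`. -/
def w4 (i j k l : Fin 7) : AlternatingMap ℝ V ℝ (Fin 4) :=
  (Matrix.detRowAlternating : AlternatingMap ℝ (Fin 4 → ℝ) ℝ (Fin 4)).compLinearMap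
    (LinearMap.pi (fun a => LinearMap.proj (![i, j, k, l] a)))

/-- Chevalley–Eilenberg differential of a 4-form, as a scalar-valued function. -/
def d4 (ψ : AlternatingMap ℝ V ℝ (Fin 4)) (x₀ x₁ x₂ x₃ x₄ : V) : ℝ :=
  -(ψ ![bk x₀ x₁, x₂, x₃, x₄]) + ψ ![bk x₀ x₂, x₁, x₃, x₄] - ψ ![bk x₀ x₃, x₁, x₂, x₄]
    + ψ ![bk x₀ x₄, x₁, x₂, x₃] - ψ ![bk x₁ x₂, x₀, x₃, x₄] + ψ ![bk x₁ x₃, x₀, x₂, x₄]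
    - ψ ![bk x₁ x₄, x₀, x₂, x₃] - ψ ![bk x₂ x₃, x₀, x₁, x₄] + ψ ![bk x₂ x₄, x₀, x₁, x₃]
    - ψ ![bk x₃ x₄, x₀, x₁, x₂]

/-- A 4-form is closed if its Chevalley–Eilenberg differential vanishes. -/
def Closed4 (ψ : AlternatingMap ℝ V ℝ (Fin 4)) : Prop :=
  ∀ x₀ x₁ x₂ x₃ x₄ : V, d4 ψ x₀ x₁ x₂ x₃ x₄ = 0

/-- A linear map `D : V → V` is a derivation of the Lie algebra `(V, bk)`. -/
def IsDeriv (D : V →ₗ[ℝ] V) : Prop :=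
  ∀ x y : V, D (bk x y) = bk (D x) y + bk x (D y)

/-- `D` stabilizes (annihilates infinitesimally) the 4-form `ψ`. -/
def Stab4 (ψ : AlternatingMap ℝ V ℝ (Fin 4)) (D : V →ₗ[ℝ] V) : Prop :=
  ∀ x y z w : V, ψ ![D x, y, z, w] + ψ ![x, D y, z, w] + ψ ![x, y, D z, w] + ψ ![x, y, z, D w] = 0

/-- The distinguished 4-form. -/
def psi : AlternatingMap ℝ V ℝ (Fin 4) :=
  -w4 0 1 2 3 + w4 0 1 4 6 + w4 0 1 5 6 - w4 0 2 4 5 + w4 0 3 5 6 - w4 1 2 5 6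
    - w4 1 3 4 5 - w4 2 3 4 6

/-- The perturbation 4-form. -/
def eta : AlternatingMap ℝ V ℝ (Fin 4) :=
  w4 1 2 4 5 + w4 1 3 4 6

/-- The standard basis vectors of `V`. -/
abbrev stdVec (i : Fin 7) : V := Pi.single i 1

section Slots

variable (ψ : AlternatingMap ℝ V ℝ (Fin 4))

lemma map_add_slot_zero (a a' b c d : V) :
    ψ ![a + a', b, c, d] = ψ ![a, b, c, d] + ψ ![a', b, c, d] := by
  have h (z : V) : Function.update ![a, b, c, d] 0 z = ![z, b, c, d] := by
    ext j : 1; fin_cases j <;> rfl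
  simpa only [h] using ψ.map_update_add ![a, b, c, d] 0 a a'

lemma map_add_slot_one (a b b' c d : V) :
    ψ ![a, b + b', c, d] = ψ ![a, b, c, d] + ψ ![a, b', c, d] := by
  have h (z : V) : Function.update ![a, b, c, d] 1 z = ![a, z, c, d] := by
    ext j : 1; fin_cases j <;> rfl
  simpa only [h] using ψ.map_update_add ![a, b, c, d] 1 b b'

lemma map_add_slot_two (a b c c' d : V) :
    ψ ![a, b, c + c', d] = ψ ![a, b, c, d] + ψ ![a, b, c', d] := by
  have h (z : V) : Function.update ![a, b, c, d] 2 z = ![a, b, z, d] := by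
    ext j : 1; fin_cases j <;> rfl
  simpa only [h] using ψ.map_update_add ![a, b, c, d] 2 c c'

lemma map_add_slot_three (a b c d d' : V) :
    ψ ![a, b, c, d + d'] = ψ ![a, b, c, d] + ψ ![a, b, c, d'] := by
  have h (z : V) : Function.update ![a, b, c, d] 3 z = ![a, b, c, z] := by
    ext j : 1; fin_cases j <;> rfl
  simpa only [h] using ψ.map_update_add ![a, b, c, d] 3 d d'

lemma map_smul_slot_zero (r : ℝ) (a b c d : V) :
    ψ ![r • a, b, c, d] = r * ψ ![a, b, c, d] := by
  have h (z : V) : Function.update ![a, b, c, d] 0 z = ![z, b, c, d] := by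
    ext j : 1; fin_cases j <;> rfl
  simpa only [h, smul_eq_mul] using ψ.map_update_smul ![a, b, c, d] 0 r a

lemma map_smul_slot_one (r : ℝ) (a b c d : V) :
    ψ ![a, r • b, c, d] = r * ψ ![a, b, c, d] := by
  have h (z : V) : Function.update ![a, b, c, d] 1 z = ![a, z, c, d] := by
    ext j : 1; fin_cases j <;> rfl
  simpa only [h, smul_eq_mul] using ψ.map_update_smul ![a, b, c, d] 1 r b

lemma map_smul_slot_two (r : ℝ) (a b c d : V) :
    ψ ![a, b, r • c, d] = r * ψ ![a, b, c, d] := by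
  have h (z : V) : Function.update ![a, b, c, d] 2 z = ![a, b, z, d] := by
    ext j : 1; fin_cases j <;> rfl
  simpa only [h, smul_eq_mul] using ψ.map_update_smul ![a, b, c, d] 2 r c

lemma map_smul_slot_three (r : ℝ) (a b c d : V) :
    ψ ![a, b, c, r • d] = r * ψ ![a, b, c, d] := by
  have h (z : V) : Function.update ![a, b, c, d] 3 z = ![a, b, c, z] := by
    ext j : 1; fin_cases j <;> rfl
  simpa only [h, smul_eq_mul] using ψ.map_update_smul ![a, b, c, d] 3 r d

lemma map_zero_slot_zero (b c d : V) : ψ ![0, b, c, d] = 0 :=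
  ψ.map_coord_zero 0 rfl

lemma map_neg_slot_zero (a b c d : V) : ψ ![-a, b, c, d] = -ψ ![a, b, c, d] := by
  simpa using map_smul_slot_zero ψ (-1) a b c d

lemma map_eq_slots_zero_one (a c d : V) : ψ ![a, a, c, d] = 0 :=
  ψ.map_eq_zero_of_eq _ (i := 0) (j := 1) rfl (by decide)

lemma map_eq_slots_zero_two (a b d : V) : ψ ![a, b, a, d] = 0 :=
  ψ.map_eq_zero_of_eq _ (i := 0) (j := 2) rfl (by decide)

lemma map_eq_slots_zero_three (a b c : V) : ψ ![a, b, c, a] = 0 :=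
  ψ.map_eq_zero_of_eq _ (i := 0) (j := 3) rfl (by decide)

lemma map_eq_slots_one_two (a b d : V) : ψ ![a, b, b, d] = 0 :=
  ψ.map_eq_zero_of_eq _ (i := 1) (j := 2) rfl (by decide)

lemma map_eq_slots_one_three (a b c : V) : ψ ![a, b, c, b] = 0 :=
  ψ.map_eq_zero_of_eq _ (i := 1) (j := 3) rfl (by decide)

lemma map_eq_slots_two_three (a b c : V) : ψ ![a, b, c, c] = 0 :=
  ψ.map_eq_zero_of_eq _ (i := 2) (j := 3) rfl (by decide)

lemma map_swap_slots_one_two (a b c d : V) : ψ ![a, b, c, d] = -ψ ![a, c, b, d] := by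
  have h := map_eq_slots_one_two ψ a (b + c) d
  rw [map_add_slot_one, map_add_slot_two, map_add_slot_two, map_eq_slots_one_two,
    map_eq_slots_one_two] at h
  linarith

lemma map_swap_slots_two_three (a b c d : V) : ψ ![a, b, c, d] = -ψ ![a, b, d, c] := by
  have h := map_eq_slots_two_three ψ a b (c + d)
  rw [map_add_slot_two, map_add_slot_three, map_add_slot_three, map_eq_slots_two_three,
    map_eq_slots_two_three] at h
  linarith

end Slots

section Bracket

lemma bk_add_left (x x' y : V) : bk (x + x') y = bk x y + bk x' y := by
  ext i; fin_cases i <;> simp [bk] <;> ring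

lemma bk_add_right (x y y' : V) : bk x (y + y') = bk x y + bk x y' := by
  ext i; fin_cases i <;> simp [bk] <;> ring

lemma bk_smul_left (r : ℝ) (x y : V) : bk (r • x) y = r • bk x y := by
  ext i; fin_cases i <;> simp [bk] <;> ring

lemma bk_smul_right (r : ℝ) (x y : V) : bk x (r • y) = r • bk x y := by
  ext i; fin_cases i <;> simp [bk] <;> ring

lemma bk_self (x : V) : bk x x = 0 := by
  ext i; fin_cases i <;> simp [bk] <;> ring

lemma bk_swap (x y : V) : bk x y = -bk y x := by
  ext i; fin_cases i <;> simp [bk] <;> ring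

end Bracket

lemma map_bk_swap (ψ : AlternatingMap ℝ V ℝ (Fin 4)) (x y a b c : V) :
    ψ ![bk x y, a, b, c] = -ψ ![bk y x, a, b, c] := by
  rw [bk_swap, map_neg_slot_zero]

/-- The Chevalley–Eilenberg differential of a 4-form, as an alternating 5-form. -/
def d4Alt (ψ : AlternatingMap ℝ V ℝ (Fin 4)) : AlternatingMap ℝ V ℝ (Fin 5) where
  toFun v := d4 ψ (v 0) (v 1) (v 2) (v 3) (v 4)
  map_update_add' := by
    intro inst v i x y
    obtain rfl : inst = instDecidableEqFin 5 := Subsingleton.elim _ _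
    fin_cases i <;>
      simp [d4, Function.update, bk_add_left, bk_add_right, map_add_slot_zero, map_add_slot_one,
        map_add_slot_two, map_add_slot_three] <;> ring
  map_update_smul' := by
    intro inst v i r x
    obtain rfl : inst = instDecidableEqFin 5 := Subsingleton.elim _ _
    fin_cases i <;>
      simp [d4, Function.update, bk_smul_left, bk_smul_right, map_smul_slot_zero,
        map_smul_slot_one, map_smul_slot_two, map_smul_slot_three] <;> ring
  map_eq_zero_of_eq' v i j h hij := by
    wlog hlt : i < j generalizing i j
    · exact this j i h.symm hij.symm (lt_of_le_of_ne (not_lt.mp hlt) hij.symm)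
    generalize hx : v 0 = x₀
    generalize hy : v 1 = x₁
    generalize hz : v 2 = x₂
    generalize hw : v 3 = x₃
    generalize hu : v 4 = x₄
    fin_cases i <;> fin_cases j <;> simp at hlt <;> simp [hx, hy, hz, hw, hu] at h <;> subst h <;>
      simp only [d4, bk_self, map_zero_slot_zero, map_eq_slots_one_two, map_eq_slots_one_three,
        map_eq_slots_two_three]
    all_goals (try simp only [neg_zero, add_zero, zero_add, sub_zero, zero_sub])
    all_goals grind only [map_swap_slots_one_two, map_swap_slots_two_three, map_bk_swap]

/-- An alternating 5-form on `V` vanishing on all increasing tuples of basis vectors is zero. -/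
lemma alternating_five_eq_zero (φ : AlternatingMap ℝ V ℝ (Fin 5))
    (h : ∀ v : Fin 5 → Fin 7, StrictMono v → φ (fun i => stdVec (v i)) = 0) : φ = 0 := by
  refine Module.Basis.ext_alternating (Pi.basisFun ℝ (Fin 7)) fun v hv => ?_
  have hmono : StrictMono (v ∘ Tuple.sort v) :=
    (Tuple.monotone_sort v).strictMono_of_injective (hv.comp (Tuple.sort v).injective)
  have h₁ := h _ hmono
  have h₂ := φ.map_perm (fun i => stdVec (v i)) (Tuple.sort v)
  have h₃ : φ ((fun i => stdVec (v i)) ∘ Tuple.sort v) = 0 := h₁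
  rw [h₃] at h₂
  rcases Int.units_eq_one_or (Equiv.Perm.sign (Tuple.sort v)) with hs | hs <;>
    simpa [hs, eq_comm] using h₂

lemma bk_zero_one : bk (stdVec 0) (stdVec 1) = -stdVec 4 := by
  ext i; fin_cases i <;> simp [bk]

lemma bk_two_three : bk (stdVec 2) (stdVec 3) = -stdVec 5 := by
  ext i; fin_cases i <;> simp [bk]

lemma bk_stdVec_of_lt {i j : Fin 7} (hij : i < j) (h₁ : ¬(i = 0 ∧ j = 1))
    (h₂ : ¬(i = 2 ∧ j = 3)) : bk (stdVec i) (stdVec j) = 0 := by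
  have h₃ : ¬(i = 1 ∧ j = 0) := by rintro ⟨rfl, rfl⟩; simp at hij
  have h₄ : ¬(i = 3 ∧ j = 2) := by rintro ⟨rfl, rfl⟩; simp at hij
  ext k
  fin_cases k <;> simp [bk, Pi.single_apply] <;> grind

lemma strictMono_five_cases : ∀ a b c d e : Fin 7, a < b → b < c → c < d → d < e →
    (a, b, c, d, e) ∈ ([(0, 1, 2, 3, 4), (0, 1, 2, 3, 5), (0, 1, 2, 3, 6), (0, 1, 2, 4, 5),
      (0, 1, 2, 4, 6), (0, 1, 2, 5, 6), (0, 1, 3, 4, 5), (0, 1, 3, 4, 6), (0, 1, 3, 5, 6),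
      (0, 1, 4, 5, 6), (0, 2, 3, 4, 5), (0, 2, 3, 4, 6), (0, 2, 3, 5, 6), (0, 2, 4, 5, 6),
      (0, 3, 4, 5, 6), (1, 2, 3, 4, 5), (1, 2, 3, 4, 6), (1, 2, 3, 5, 6), (1, 2, 4, 5, 6),
      (1, 3, 4, 5, 6), (2, 3, 4, 5, 6)] : List (Fin 7 × Fin 7 × Fin 7 × Fin 7 × Fin 7)) := by
  decide

/-- The seven linear conditions cutting out the closed 4-forms. -/
def closedConditions : AlternatingMap ℝ V ℝ (Fin 4) →ₗ[ℝ] (Fin 7 → ℝ) where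
  toFun ψ := ![ψ ![stdVec 5, stdVec 0, stdVec 1, stdVec 4],
    ψ ![stdVec 4, stdVec 2, stdVec 3, stdVec 5],
    ψ ![stdVec 4, stdVec 2, stdVec 3, stdVec 6] + ψ ![stdVec 5, stdVec 0, stdVec 1, stdVec 6],
    ψ ![stdVec 4, stdVec 2, stdVec 5, stdVec 6],
    ψ ![stdVec 4, stdVec 3, stdVec 5, stdVec 6],
    ψ ![stdVec 5, stdVec 0, stdVec 4, stdVec 6],
    ψ ![stdVec 5, stdVec 1, stdVec 4, stdVec 6]]
  map_add' ψ χ := by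
    ext k; fin_cases k <;> simp [add_add_add_comm]
  map_smul' r ψ := by
    ext k; fin_cases k <;> simp [mul_add]

lemma closedConditions_eq_zero_iff (ψ : AlternatingMap ℝ V ℝ (Fin 4)) :
    closedConditions ψ = 0 ↔ Closed4 ψ := by
  have hbk {i j : Fin 7} := @bk_stdVec_of_lt i j
  constructor
  · intro h
    simp only [closedConditions, LinearMap.coe_mk, AddHom.coe_mk, funext_iff, Fin.forall_fin_succ,
      Pi.zero_apply, Matrix.cons_val_zero, Matrix.cons_val_succ, IsEmpty.forall_iff, and_true] at h
    obtain ⟨h₁, h₂, h₃, h₄, h₅, h₆, h₇⟩ := h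
    have hz : d4Alt ψ = 0 := by
      refine alternating_five_eq_zero _ fun v hv => ?_
      have hcases := strictMono_five_cases (v 0) (v 1) (v 2) (v 3) (v 4) (hv (by decide))
        (hv (by decide)) (hv (by decide)) (hv (by decide))
      change d4 ψ (stdVec (v 0)) (stdVec (v 1)) (stdVec (v 2)) (stdVec (v 3)) (stdVec (v 4)) = 0
      generalize v 0 = a, v 1 = b, v 2 = c, v 3 = d, v 4 = e at hcases ⊢
      simp only [List.mem_cons, Prod.mk.injEq, List.not_mem_nil, or_false] at hcases
      rcases hcases with h | h | h | h | h | h | h | h | h | h | h | h | h | h | h | h | h | h | h |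
          h | h <;>
        obtain ⟨rfl, rfl, rfl, rfl, rfl⟩ := h <;>
        simp (disch := decide) only [d4, bk_zero_one, bk_two_three, hbk, map_zero_slot_zero,
          map_neg_slot_zero, map_eq_slots_zero_one, map_eq_slots_zero_two,
          map_eq_slots_zero_three] <;>
        linarith
    intro x₀ x₁ x₂ x₃ x₄
    exact congrArg (fun φ : AlternatingMap ℝ V ℝ (Fin 5) => φ ![x₀, x₁, x₂, x₃, x₄]) hz
  · intro h
    have key (a b c d e : Fin 7) := h (stdVec a) (stdVec b) (stdVec c) (stdVec d) (stdVec e)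
    have h₁ := key 0 1 2 3 4
    have h₂ := key 0 1 2 3 5
    have h₃ := key 0 1 2 3 6
    have h₄ := key 0 1 2 5 6
    have h₅ := key 0 1 3 5 6
    have h₆ := key 0 2 3 4 6
    have h₇ := key 1 2 3 4 6
    simp (disch := decide) only [d4, bk_zero_one, bk_two_three, hbk, map_zero_slot_zero,
      map_neg_slot_zero, map_eq_slots_zero_three] at h₁ h₂ h₃ h₄ h₅ h₆ h₇
    ext k
    fin_cases k <;> simp [closedConditions] <;> linarith

lemma w4_apply (i j k l : Fin 7) (x y z w : V) :
    w4 i j k l ![x, y, z, w] =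
      x i * (y j * (z k * w l - z l * w k) - y k * (z j * w l - z l * w j)
        + y l * (z j * w k - z k * w j))
      - x j * (y i * (z k * w l - z l * w k) - y k * (z i * w l - z l * w i)
        + y l * (z i * w k - z k * w i))
      + x k * (y i * (z j * w l - z l * w j) - y j * (z i * w l - z l * w i)
        + y l * (z i * w j - z j * w i))
      - x l * (y i * (z j * w k - z k * w j) - y j * (z i * w k - z k * w i)
        + y k * (z i * w j - z j * w i)) := by
  have h : w4 i j k l ![x, y, z, w] = Matrix.det !![x i, x j, x k, x l; y i, y j, y k, y l;
      z i, z j, z k, z l; w i, w j, w k, w l] := by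
    refine congrArg Matrix.det
      (?_ : (fun a b => (![x, y, z, w] a) (![i, j, k, l] b) : Matrix (Fin 4) (Fin 4) ℝ) = _)
    ext a b
    fin_cases a <;> fin_cases b <;> rfl
  rw [h, Matrix.det_succ_row_zero]
  simp [Fin.sum_univ_succ, Matrix.det_fin_three, Fin.succAbove]
  ring

lemma closedConditions_surjective : Function.Surjective closedConditions := by
  intro y
  refine ⟨y 0 • w4 5 0 1 4 + y 1 • w4 4 2 3 5 + y 2 • w4 4 2 3 6 + y 3 • w4 4 2 5 6 +
    y 4 • w4 4 3 5 6 + y 5 • w4 5 0 4 6 + y 6 • w4 5 1 4 6, ?_⟩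
  ext k
  fin_cases k <;> simp [closedConditions, w4_apply]

lemma finrank_alternatingMap :
    Module.finrank ℝ (AlternatingMap ℝ V ℝ (Fin 4)) = 35 := by
  rw [(exteriorPower.alternatingMapLinearEquiv (R := ℝ) (M := V) (N := ℝ) (n := 4)).finrank_eq]
  rw [show Module.finrank ℝ ((⋀[ℝ]^4 V) →ₗ[ℝ] ℝ) = _ from Subspace.dual_finrank_eq,
    exteriorPower.finrank_eq]
  simp
  decide

lemma finrank_ker_closedConditions : Module.finrank ℝ (LinearMap.ker closedConditions) = 28 := by
  have : FiniteDimensional ℝ (AlternatingMap ℝ V ℝ (Fin 4)) :=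
    Module.finite_of_finrank_pos (by rw [finrank_alternatingMap]; norm_num)
  have h := closedConditions.finrank_range_add_finrank_ker
  rw [LinearMap.range_eq_top.mpr closedConditions_surjective, finrank_top,
    finrank_alternatingMap] at h
  simp at h
  omega

/-- The 26 linear conditions on matrix entries cutting out the derivations. -/
def derivConditions :
    (V →ₗ[ℝ] V) →ₗ[ℝ] (Fin 2 → Fin 5 → ℝ) × (Fin 2 → Fin 5 → ℝ) × (Fin 6 → ℝ) where
  toFun D := (fun i j => D (stdVec (![2, 3, 4, 5, 6] j)) (![0, 1] i),
    fun i j => D (stdVec (![0, 1, 4, 5, 6] j)) (![2, 3] i),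
    ![D (stdVec 5) 4, D (stdVec 4) 5, D (stdVec 4) 6, D (stdVec 5) 6,
      D (stdVec 4) 4 - (D (stdVec 0) 0 + D (stdVec 1) 1),
      D (stdVec 5) 5 - (D (stdVec 2) 2 + D (stdVec 3) 3)])
  map_add' D E := by
    refine Prod.ext rfl (Prod.ext rfl ?_)
    ext k; fin_cases k <;> simp <;> ring
  map_smul' r D := by
    refine Prod.ext rfl (Prod.ext rfl ?_)
    ext k; fin_cases k <;> simp <;> ring

lemma apply_eq_sum (D : V →ₗ[ℝ] V) (x : V) (i : Fin 7) :
    D x i = x 0 * D (stdVec 0) i + x 1 * D (stdVec 1) i + x 2 * D (stdVec 2) i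
      + x 3 * D (stdVec 3) i + x 4 * D (stdVec 4) i + x 5 * D (stdVec 5) i
      + x 6 * D (stdVec 6) i := by
  conv_lhs => rw [pi_eq_sum_univ' x]
  simp [Fin.sum_univ_seven, stdVec]

lemma isDeriv_iff_entries (D : V →ₗ[ℝ] V) : IsDeriv D ↔
    (D (stdVec 2) 0 = 0 ∧ D (stdVec 3) 0 = 0 ∧ D (stdVec 4) 0 = 0 ∧ D (stdVec 5) 0 = 0 ∧
      D (stdVec 6) 0 = 0) ∧
    (D (stdVec 2) 1 = 0 ∧ D (stdVec 3) 1 = 0 ∧ D (stdVec 4) 1 = 0 ∧ D (stdVec 5) 1 = 0 ∧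
      D (stdVec 6) 1 = 0) ∧
    (D (stdVec 0) 2 = 0 ∧ D (stdVec 1) 2 = 0 ∧ D (stdVec 4) 2 = 0 ∧ D (stdVec 5) 2 = 0 ∧
      D (stdVec 6) 2 = 0) ∧
    (D (stdVec 0) 3 = 0 ∧ D (stdVec 1) 3 = 0 ∧ D (stdVec 4) 3 = 0 ∧ D (stdVec 5) 3 = 0 ∧
      D (stdVec 6) 3 = 0) ∧
    D (stdVec 5) 4 = 0 ∧ D (stdVec 4) 5 = 0 ∧ D (stdVec 4) 6 = 0 ∧ D (stdVec 5) 6 = 0 ∧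
    D (stdVec 4) 4 = D (stdVec 0) 0 + D (stdVec 1) 1 ∧
    D (stdVec 5) 5 = D (stdVec 2) 2 + D (stdVec 3) 3 := by
  constructor
  · intro h
    have key (a b k : Fin 7) := congrFun (h (stdVec a) (stdVec b)) k
    have h₀ (b : Fin 7) (hb₀ : b ≠ 0) (hb₁ : b ≠ 1) : D (stdVec b) 1 = 0 := by
      have hb : bk (stdVec 0) (stdVec b) = 0 := by
        ext k; fin_cases k <;> simp [bk, hb₁.symm]
      have hk := key 0 b 4
      rw [hb, map_zero] at hk
      simpa [bk, hb₀.symm, hb₁.symm] using hk.symm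
    have h₁ (b : Fin 7) (hb₀ : b ≠ 0) (hb₁ : b ≠ 1) : D (stdVec b) 0 = 0 := by
      have hb : bk (stdVec 1) (stdVec b) = 0 := by
        ext k; fin_cases k <;> simp [bk, hb₀.symm]
      have hk := key 1 b 4
      rw [hb, map_zero] at hk
      simpa [bk, hb₀.symm, hb₁.symm] using hk.symm
    have h₂ (b : Fin 7) (hb₂ : b ≠ 2) (hb₃ : b ≠ 3) : D (stdVec b) 3 = 0 := by
      have hb : bk (stdVec 2) (stdVec b) = 0 := by
        ext k; fin_cases k <;> simp [bk, hb₃.symm]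
      have hk := key 2 b 5
      rw [hb, map_zero] at hk
      simpa [bk, hb₂.symm, hb₃.symm] using hk.symm
    have h₃ (b : Fin 7) (hb₂ : b ≠ 2) (hb₃ : b ≠ 3) : D (stdVec b) 2 = 0 := by
      have hb : bk (stdVec 3) (stdVec b) = 0 := by
        ext k; fin_cases k <;> simp [bk, hb₂.symm]
      have hk := key 3 b 5
      rw [hb, map_zero] at hk
      simpa [bk, hb₂.symm, hb₃.symm] using hk.symm
    have h01 := key 0 1
    have h23 := key 2 3
    rw [bk_zero_one, map_neg] at h01
    rw [bk_two_three, map_neg] at h23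
    have h44 := h01 4
    have h45 := h01 5
    have h46 := h01 6
    have h54 := h23 4
    have h55 := h23 5
    have h56 := h23 6
    simp [bk] at h44 h45 h46 h54 h55 h56
    refine ⟨⟨?_, ?_, ?_, ?_, ?_⟩, ⟨?_, ?_, ?_, ?_, ?_⟩, ⟨?_, ?_, ?_, ?_, ?_⟩, ⟨?_, ?_, ?_, ?_, ?_⟩,
      h54, h45, h46, h56, by linarith, by linarith⟩
    all_goals
      first
      | exact h₀ _ (by decide) (by decide)
      | exact h₁ _ (by decide) (by decide)
      | exact h₂ _ (by decide) (by decide)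
      | exact h₃ _ (by decide) (by decide)
  · rintro ⟨⟨h₁, h₂, h₃, h₄, h₅⟩, ⟨h₆, h₇, h₈, h₉, h₁₀⟩, ⟨h₁₁, h₁₂, h₁₃, h₁₄, h₁₅⟩,
      ⟨h₁₆, h₁₇, h₁₈, h₁₉, h₂₀⟩, h₂₁, h₂₂, h₂₃, h₂₄, h₂₅, h₂₆⟩ x y
    have hx := apply_eq_sum D x
    have hy := apply_eq_sum D y
    ext i
    rw [apply_eq_sum D (bk x y) i]
    fin_cases i <;> simp [bk, *] <;> ring

lemma derivConditions_eq_zero_iff (D : V →ₗ[ℝ] V) : derivConditions D = 0 ↔ IsDeriv D := by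
  rw [isDeriv_iff_entries]
  simp only [derivConditions, LinearMap.coe_mk, AddHom.coe_mk, Prod.mk_eq_zero, funext_iff,
    Fin.forall_fin_two]
  simp [Fin.forall_fin_succ, sub_eq_zero, and_assoc]

lemma derivConditions_surjective : Function.Surjective derivConditions := by
  rintro ⟨p, q, r⟩
  refine ⟨Matrix.toLin' !![0, 0, p 0 0, p 0 1, p 0 2, p 0 3, p 0 4;
    0, 0, p 1 0, p 1 1, p 1 2, p 1 3, p 1 4;
    q 0 0, q 0 1, 0, 0, q 0 2, q 0 3, q 0 4; q 1 0, q 1 1, 0, 0, q 1 2, q 1 3, q 1 4;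
    0, 0, 0, 0, r 4, r 0, 0; 0, 0, 0, 0, r 1, r 5, 0; 0, 0, 0, 0, r 2, r 3, 0], ?_⟩
  refine Prod.ext ?_ (Prod.ext ?_ ?_)
  · ext i j
    fin_cases i <;> fin_cases j <;> simp [derivConditions]
  · ext i j
    fin_cases i <;> fin_cases j <;> simp [derivConditions]
  · ext k
    fin_cases k <;> simp [derivConditions]

lemma finrank_ker_derivConditions : Module.finrank ℝ (LinearMap.ker derivConditions) = 23 := by
  have h := derivConditions.finrank_range_add_finrank_ker
  rw [LinearMap.range_eq_top.mpr derivConditions_surjective, finrank_top,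
    Module.finrank_linearMap] at h
  simp [Module.finrank_pi_fintype] at h
  omega

/-- The generator of the line of derivations stabilizing `psi`. -/
def psiStabilizer : V →ₗ[ℝ] V where
  toFun x := ![-x 1, x 0, -x 3, x 2, 0, 0, 0]
  map_add' x y := by
    ext i; fin_cases i <;> simp <;> ring
  map_smul' r x := by
    ext i; fin_cases i <;> simp

lemma psiStabilizer_isDeriv : IsDeriv psiStabilizer := by
  intro x y
  ext i
  fin_cases i <;> simp [psiStabilizer, bk]

lemma psiStabilizer_stab : Stab4 psi psiStabilizer := by
  intro x y z w
  simp [psi, psiStabilizer, w4_apply]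
  ring

lemma psiStabilizer_ne_zero : psiStabilizer ≠ 0 := by
  intro h
  simpa [psiStabilizer] using congrFun (LinearMap.congr_fun h (stdVec 0)) 1

lemma IsDeriv.smul {D : V →ₗ[ℝ] V} (hD : IsDeriv D) (r : ℝ) : IsDeriv (r • D) := by
  intro x y
  simp only [LinearMap.smul_apply, bk_smul_left, bk_smul_right, hD x y, smul_add]

lemma Stab4.smul {ψ : AlternatingMap ℝ V ℝ (Fin 4)} {D : V →ₗ[ℝ] V} (hD : Stab4 ψ D) (r : ℝ) :
    Stab4 ψ (r • D) := by
  intro x y z w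
  simp only [LinearMap.smul_apply, map_smul_slot_zero, map_smul_slot_one, map_smul_slot_two,
    map_smul_slot_three, ← mul_add, hD x y z w, mul_zero]

lemma diagonal_entries_of_stab {ε : ℝ} {D : V →ₗ[ℝ] V} (hD : IsDeriv D)
    (hS : Stab4 (psi + ε • eta) D) :
    ε * D (stdVec 0) 1 = 0 ∧ D (stdVec 0) 0 = 0 ∧ D (stdVec 1) 1 = 0 ∧ D (stdVec 2) 2 = 0 ∧
      D (stdVec 3) 3 = 0 ∧ D (stdVec 6) 6 = 0 ∧ D (stdVec 6) 5 = 0 ∧ D (stdVec 6) 4 = 0 ∧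
      D (stdVec 2) 3 = D (stdVec 0) 1 ∧ D (stdVec 3) 2 = -D (stdVec 0) 1 ∧
      D (stdVec 1) 0 = -D (stdVec 0) 1 := by
  obtain ⟨⟨h₁, h₂, h₃, h₄, h₅⟩, ⟨h₆, h₇, h₈, h₉, h₁₀⟩, ⟨h₁₁, h₁₂, h₁₃, h₁₄, h₁₅⟩,
    ⟨h₁₆, h₁₇, h₁₈, h₁₉, h₂₀⟩, h₂₁, h₂₂, h₂₃, h₂₄, h₂₅, h₂₆⟩ := (isDeriv_iff_entries D).mp hD
  have key (a b c d : Fin 7) := hS (stdVec a) (stdVec b) (stdVec c) (stdVec d)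
  have q0346 : ε * D (stdVec 0) 1 = 0 := by
    have h := key 0 3 4 6
    simp [psi, eta, w4_apply, *] at h
    simpa using h
  have q0146 : 2 * D (stdVec 0) 0 + 2 * D (stdVec 1) 1 + D (stdVec 6) 6 = 0 := by
    have h := key 0 1 4 6
    simp [psi, eta, w4_apply, *] at h
    linarith
  have q2346 : -D (stdVec 0) 0 - D (stdVec 1) 1 - D (stdVec 2) 2 - D (stdVec 3) 3 - D (stdVec 6) 6
      = 0 := by
    have h := key 2 3 4 6
    simp [psi, eta, w4_apply, *] at h
    linarith
  have q0123 : -D (stdVec 0) 0 - D (stdVec 1) 1 - D (stdVec 2) 2 - D (stdVec 3) 3 = 0 := by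
    have h := key 0 1 2 3
    simp [psi, eta, w4_apply, *] at h
    linarith
  have q0356 : D (stdVec 0) 0 + D (stdVec 2) 2 + 2 * D (stdVec 3) 3 + D (stdVec 6) 6 = 0 := by
    have h := key 0 3 5 6
    simp [psi, eta, w4_apply, *] at h
    linarith
  have q0245 : ε * D (stdVec 0) 1 - 2 * D (stdVec 0) 0 - D (stdVec 1) 1 - 2 * D (stdVec 2) 2 -
      D (stdVec 3) 3 = 0 := by
    have h := key 0 2 4 5
    simp [psi, eta, w4_apply, *] at h
    linarith
  have q0246 : -D (stdVec 6) 5 = 0 := by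
    have h := key 0 2 4 6
    simp [psi, eta, w4_apply, *] at h
    linarith
  have q0256 : D (stdVec 2) 3 + D (stdVec 6) 4 - D (stdVec 0) 1 = 0 := by
    have h := key 0 2 5 6
    simp [psi, eta, w4_apply, *] at h
    linarith
  have q0345 : -D (stdVec 0) 1 - D (stdVec 3) 2 = 0 := by
    have h := key 0 3 4 5
    simp [psi, eta, w4_apply, *] at h
    linarith
  have q1356 : D (stdVec 1) 0 + D (stdVec 6) 4 - D (stdVec 3) 2 = 0 := by
    have h := key 1 3 5 6
    simp [psi, eta, w4_apply, *] at h
    linarith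
  have q1245 : ε * D (stdVec 0) 0 + 2 * ε * D (stdVec 1) 1 + 2 * ε * D (stdVec 2) 2 +
      ε * D (stdVec 3) 3 - D (stdVec 1) 0 - D (stdVec 2) 3 = 0 := by
    have h := key 1 2 4 5
    simp [psi, eta, w4_apply, *] at h
    linarith
  have ha₀ : D (stdVec 0) 0 = 0 := by linarith
  have hb₁ : D (stdVec 1) 1 = 0 := by linarith
  have hc₂ : D (stdVec 2) 2 = 0 := by linarith
  have hd₃ : D (stdVec 3) 3 = 0 := by linarith
  rw [ha₀, hb₁, hc₂, hd₃] at q1245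
  refine ⟨q0346, ha₀, hb₁, hc₂, hd₃, ?_, ?_, ?_, ?_, ?_, ?_⟩ <;> linarith

lemma lower_system_eq_zero {ε e₀ e₁ e₂ e₃ f₀ f₁ f₂ f₃ g₀ g₁ g₂ g₃ : ℝ} (hε : |ε| < 1)
    (q0234 : f₃ + g₀ = 0) (q0235 : g₂ - e₃ = 0) (q0236 : -e₀ - f₂ = 0)
    (q0124 : -ε * f₀ - f₁ - g₂ = 0) (q0125 : ε * e₀ + e₁ + g₀ - g₂ = 0)
    (q0126 : e₂ + f₂ - f₀ = 0) (q0134 : f₀ - ε * g₀ - g₃ = 0) (q0135 : g₁ - e₀ - g₃ = 0)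
    (q0136 : ε * e₀ + e₃ + f₃ - f₁ = 0) (q1234 : g₁ + ε * g₂ - f₂ - ε * f₃ = 0)
    (q1235 : e₂ + ε * e₃ + g₃ = 0) (q1236 : -e₁ - ε * e₂ - f₃ = 0) :
    (e₀ = 0 ∧ e₁ = 0 ∧ e₂ = 0 ∧ e₃ = 0) ∧ (f₀ = 0 ∧ f₁ = 0 ∧ f₂ = 0 ∧ f₃ = 0) ∧
      (g₀ = 0 ∧ g₁ = 0 ∧ g₂ = 0 ∧ g₃ = 0) := by
  obtain rfl : f₃ = -g₀ := by linarith
  obtain rfl : g₂ = e₃ := by linarith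
  obtain rfl : f₂ = -e₀ := by linarith
  obtain rfl : f₁ = -(ε * f₀) - g₂ := by linarith
  obtain rfl : g₃ = f₀ - ε * g₀ := by linarith
  obtain rfl : g₁ = e₀ + (f₀ - ε * g₀) := by linarith
  obtain rfl : e₂ = f₀ + e₀ := by linarith
  obtain rfl : e₁ = g₀ - ε * (f₀ + e₀) := by linarith
  obtain rfl : g₂ = 2 * g₀ - ε * f₀ := by linarith
  have hε₂ : 3 - ε ^ 2 ≠ 0 := by
    have h := (sq_lt_one_iff_abs_lt_one ε).mpr hε
    intro h'
    linarith
  obtain rfl : g₀ = 0 := (mul_eq_zero.mp (show (3 - ε ^ 2) * g₀ = 0 by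
    linear_combination q0136 - ε * (q1234 - q1235))).resolve_left hε₂
  obtain rfl : e₀ = f₀ := by linarith
  obtain rfl : e₀ = 0 := (mul_eq_zero.mp (show (3 - ε ^ 2) * e₀ = 0 by
    linear_combination q1234)).resolve_left hε₂
  simp

set_option maxHeartbeats 1000000 in
lemma lower_entries_of_stab {ε : ℝ} {D : V →ₗ[ℝ] V} (hD : IsDeriv D)
    (hS : Stab4 (psi + ε • eta) D) (hε : |ε| < 1) :
    (D (stdVec 0) 4 = 0 ∧ D (stdVec 1) 4 = 0 ∧ D (stdVec 2) 4 = 0 ∧ D (stdVec 3) 4 = 0) ∧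
    (D (stdVec 0) 5 = 0 ∧ D (stdVec 1) 5 = 0 ∧ D (stdVec 2) 5 = 0 ∧ D (stdVec 3) 5 = 0) ∧
    (D (stdVec 0) 6 = 0 ∧ D (stdVec 1) 6 = 0 ∧ D (stdVec 2) 6 = 0 ∧ D (stdVec 3) 6 = 0) := by
  obtain ⟨⟨h₁, h₂, h₃, h₄, h₅⟩, ⟨h₆, h₇, h₈, h₉, h₁₀⟩, ⟨h₁₁, h₁₂, h₁₃, h₁₄, h₁₅⟩,
    ⟨h₁₆, h₁₇, h₁₈, h₁₉, h₂₀⟩, h₂₁, h₂₂, h₂₃, h₂₄, h₂₅, h₂₆⟩ := (isDeriv_iff_entries D).mp hD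
  have key (a b c d : Fin 7) := hS (stdVec a) (stdVec b) (stdVec c) (stdVec d)
  have q0234 : D (stdVec 3) 5 + D (stdVec 0) 6 = 0 := by
    have h := key 0 2 3 4
    simp [psi, eta, w4_apply, *] at h
    linarith
  have q0235 : D (stdVec 2) 6 - D (stdVec 3) 4 = 0 := by
    have h := key 0 2 3 5
    simp [psi, eta, w4_apply, *] at h
    linarith
  have q0236 : -D (stdVec 0) 4 - D (stdVec 2) 5 = 0 := by
    have h := key 0 2 3 6
    simp [psi, eta, w4_apply, *] at h
    linarith
  have q0124 : -ε * D (stdVec 0) 5 - D (stdVec 1) 5 - D (stdVec 2) 6 = 0 := by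
    have h := key 0 1 2 4
    simp [psi, eta, w4_apply, *] at h
    linarith
  have q0125 : ε * D (stdVec 0) 4 + D (stdVec 1) 4 + D (stdVec 0) 6 - D (stdVec 2) 6 = 0 := by
    have h := key 0 1 2 5
    simp [psi, eta, w4_apply, *] at h
    linarith
  have q0126 : D (stdVec 2) 4 + D (stdVec 2) 5 - D (stdVec 0) 5 = 0 := by
    have h := key 0 1 2 6
    simp [psi, eta, w4_apply, *] at h
    linarith
  have q0134 : D (stdVec 0) 5 - ε * D (stdVec 0) 6 - D (stdVec 3) 6 = 0 := by
    have h := key 0 1 3 4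
    simp [psi, eta, w4_apply, *] at h
    linarith
  have q0135 : D (stdVec 1) 6 - D (stdVec 0) 4 - D (stdVec 3) 6 = 0 := by
    have h := key 0 1 3 5
    simp [psi, eta, w4_apply, *] at h
    linarith
  have q0136 : ε * D (stdVec 0) 4 + D (stdVec 3) 4 + D (stdVec 3) 5 - D (stdVec 1) 5 = 0 := by
    have h := key 0 1 3 6
    simp [psi, eta, w4_apply, *] at h
    linarith
  have q1234 : D (stdVec 1) 6 + ε * D (stdVec 2) 6 - D (stdVec 2) 5 - ε * D (stdVec 3) 5 = 0 := by
    have h := key 1 2 3 4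
    simp [psi, eta, w4_apply, *] at h
    linarith
  have q1235 : D (stdVec 2) 4 + ε * D (stdVec 3) 4 + D (stdVec 3) 6 = 0 := by
    have h := key 1 2 3 5
    simp [psi, eta, w4_apply, *] at h
    linarith
  have q1236 : -D (stdVec 1) 4 - ε * D (stdVec 2) 4 - D (stdVec 3) 5 = 0 := by
    have h := key 1 2 3 6
    simp [psi, eta, w4_apply, *] at h
    linarith
  exact lower_system_eq_zero hε q0234 q0235 q0236 q0124 q0125 q0126 q0134
    q0135 q0136 q1234 q1235 q1236

lemma eq_smul_psiStabilizer {ε : ℝ} (hε : |ε| < 1) {D : V →ₗ[ℝ] V} (hD : IsDeriv D)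
    (hS : Stab4 (psi + ε • eta) D) :
    ε * D (stdVec 0) 1 = 0 ∧ D = D (stdVec 0) 1 • psiStabilizer := by
  obtain ⟨hb₀, ha₀, hb₁, hc₂, hd₃, hg₆, hf₆, he₆, hd₂, hc₃, ha₁⟩ := diagonal_entries_of_stab hD hS
  refine ⟨hb₀, LinearMap.ext fun x => ?_⟩
  clear hb₀
  obtain ⟨⟨h₁, h₂, h₃, h₄⟩, ⟨h₅, h₆, h₇, h₈⟩, ⟨h₉, h₁₀, h₁₁, h₁₂⟩⟩ := lower_entries_of_stab hD hS hε
  obtain ⟨⟨k₁, k₂, k₃, k₄, k₅⟩, ⟨k₆, k₇, k₈, k₉, k₁₀⟩, ⟨k₁₁, k₁₂, k₁₃, k₁₄, k₁₅⟩,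
    ⟨k₁₆, k₁₇, k₁₈, k₁₉, k₂₀⟩, k₂₁, k₂₂, k₂₃, k₂₄, k₂₅, k₂₆⟩ := (isDeriv_iff_entries D).mp hD
  ext i
  rw [apply_eq_sum D x i]
  fin_cases i <;> simp [psiStabilizer, *] <;> ring

theorem statement_13 :
    (∃ Z : Submodule ℝ (AlternatingMap ℝ V ℝ (Fin 4)),
      (∀ ψ, ψ ∈ Z ↔ Closed4 ψ) ∧ Module.finrank ℝ Z = 28) ∧
    (∃ W : Submodule ℝ (V →ₗ[ℝ] V),
      (∀ D, D ∈ W ↔ IsDeriv D) ∧ Module.finrank ℝ W = 23) ∧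
    Closed4 psi ∧
    (∃ S : Submodule ℝ (V →ₗ[ℝ] V),
      (∀ D, D ∈ S ↔ IsDeriv D ∧ Stab4 psi D) ∧ Module.finrank ℝ S = 1) ∧
    (∃ δ : ℝ, 0 < δ ∧ ∀ ε : ℝ, 0 < |ε| → |ε| < δ →
      ∀ D : V →ₗ[ℝ] V, IsDeriv D → Stab4 (psi + ε • eta) D → D = 0) := by
  have hker : Closed4 psi := by
    rw [← closedConditions_eq_zero_iff]
    ext k
    fin_cases k <;> simp [closedConditions, psi, w4_apply]
  refine ⟨⟨LinearMap.ker closedConditions, fun ψ => ?_, finrank_ker_closedConditions⟩,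
    ⟨LinearMap.ker derivConditions, fun D => ?_, finrank_ker_derivConditions⟩, hker,
    ⟨ℝ ∙ psiStabilizer, fun D => ?_, finrank_span_singleton psiStabilizer_ne_zero⟩,
    1, one_pos, fun ε hε₀ hε₁ D hD hS => ?_⟩
  · rw [LinearMap.mem_ker, closedConditions_eq_zero_iff]
  · rw [LinearMap.mem_ker, derivConditions_eq_zero_iff]
  · rw [Submodule.mem_span_singleton]
    constructor
    · rintro ⟨r, rfl⟩
      exact ⟨psiStabilizer_isDeriv.smul r, psiStabilizer_stab.smul r⟩
    · rintro ⟨hD, hS⟩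
      exact ⟨_, (eq_smul_psiStabilizer (ε := 0) (by simp) hD (by simpa using hS)).2.symm⟩
  · obtain ⟨h₁, h₂⟩ := eq_smul_psiStabilizer hε₁ hD hS
    rw [h₂, (mul_eq_zero.mp h₁).resolve_left (abs_pos.mp hε₀), zero_smul]
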